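/- arXiv:1506.05305 — 2 statements merged into one kernel-verified Lean document; each statement's English description precedes it below -/
import Mathlib

section
/- Let K ⊆ ℝ^n be a convex set, let M ≥ 0, and let v : K → ℝ be a nonnegative concave function satisfying |v(x) − v(y)| ≤ M|x−y| for all x, y ∈ K. Then u := v² is semiconcave on K with constant 2M², i.e., u(λx + (1−λ)y) ≥ λu(x) + (1−λ)u(y) − M²·λ(1−λ)·|x−y|² for all x, y ∈ K and all λ ∈ [0,1]. -/
open Set Metric Filter
open scoped RealInnerProductSpace

noncomputable section

/-- The Hessian of `φ` at `x`, as the Fréchet derivative of the gradient. -/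
def hessianCLM {n : ℕ} (φ : EuclideanSpace ℝ (Fin n) → ℝ) (x : EuclideanSpace ℝ (Fin n)) :
    EuclideanSpace ℝ (Fin n) →L[ℝ] EuclideanSpace ℝ (Fin n) :=
  fderiv ℝ (gradient φ) x

/-- The maximum eigenvalue of a symmetric operator, as the supremum of the
quadratic form over unit vectors. -/
def lamMax {n : ℕ} (A : EuclideanSpace ℝ (Fin n) →L[ℝ] EuclideanSpace ℝ (Fin n)) : ℝ :=
  sSup ((fun v => ⟪A v, v⟫) '' {v | ‖v‖ = 1})

/-- The minimum eigenvalue of a symmetric operator, as the infimum of the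
quadratic form over unit vectors. -/
def lamMin {n : ℕ} (A : EuclideanSpace ℝ (Fin n) →L[ℝ] EuclideanSpace ℝ (Fin n)) : ℝ :=
  sInf ((fun v => ⟪A v, v⟫) '' {v | ‖v‖ = 1})

/-- The (not normalized) infinity Laplacian `Δ∞φ(x) = ⟨∇²φ(x) ∇φ(x), ∇φ(x)⟩`. -/
def infLap {n : ℕ} (φ : EuclideanSpace ℝ (Fin n) → ℝ) (x : EuclideanSpace ℝ (Fin n)) : ℝ :=
  ⟪hessianCLM φ x (gradient φ x), gradient φ x⟫

/-- Viscosity subsolution of `-Δ∞^N u = f` in `Ω`. -/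
def IsNSubsol {n : ℕ} (Ω : Set (EuclideanSpace ℝ (Fin n))) (f : EuclideanSpace ℝ (Fin n) → ℝ)
    (u : EuclideanSpace ℝ (Fin n) → ℝ) : Prop :=
  UpperSemicontinuousOn u Ω ∧
  ∀ x ∈ Ω, ∀ φ : EuclideanSpace ℝ (Fin n) → ℝ, ContDiffOn ℝ 2 φ Ω →
    φ x = u x → (∀ y ∈ Ω, u y ≤ φ y) →
    (gradient φ x ≠ 0 → -infLap φ x ≤ f x * ‖gradient φ x‖ ^ 2) ∧
    (gradient φ x = 0 → -lamMax (hessianCLM φ x) ≤ f x)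

/-- Viscosity supersolution of `-Δ∞^N u = f` in `Ω`. -/
def IsNSupersol {n : ℕ} (Ω : Set (EuclideanSpace ℝ (Fin n))) (f : EuclideanSpace ℝ (Fin n) → ℝ)
    (u : EuclideanSpace ℝ (Fin n) → ℝ) : Prop :=
  LowerSemicontinuousOn u Ω ∧
  ∀ x ∈ Ω, ∀ φ : EuclideanSpace ℝ (Fin n) → ℝ, ContDiffOn ℝ 2 φ Ω →
    φ x = u x → (∀ y ∈ Ω, φ y ≤ u y) →
    (gradient φ x ≠ 0 → f x * ‖gradient φ x‖ ^ 2 ≤ -infLap φ x) ∧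
    (gradient φ x = 0 → f x ≤ -lamMin (hessianCLM φ x))

/-- Viscosity solution of the Dirichlet problem `-Δ∞^N u = 1` in `Ω`, `u = 0` on `∂Ω`. -/
def IsDirichletSol {n : ℕ} (Ω : Set (EuclideanSpace ℝ (Fin n)))
    (u : EuclideanSpace ℝ (Fin n) → ℝ) : Prop :=
  ContinuousOn u (closure Ω) ∧ (∀ x ∈ frontier Ω, u x = 0) ∧
  IsNSubsol Ω (fun _ => 1) u ∧ IsNSupersol Ω (fun _ => 1) u

/-- `u` is semiconcave with constant `C` on `K`. -/
def SemiconcaveWith {n : ℕ} (C : ℝ) (K : Set (EuclideanSpace ℝ (Fin n)))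
    (u : EuclideanSpace ℝ (Fin n) → ℝ) : Prop :=
  ∀ x ∈ K, ∀ y ∈ K, ∀ t : ℝ, 0 ≤ t → t ≤ 1 →
    t * u x + (1 - t) * u y - C / 2 * (t * (1 - t)) * ‖x - y‖ ^ 2 ≤ u (t • x + (1 - t) • y)

/-- `u` is locally semiconcave in `Ω`: semiconcave (with some constant) on every
compact convex subset of `Ω`. -/
def LocallySemiconcaveOn {n : ℕ} (Ω : Set (EuclideanSpace ℝ (Fin n)))
    (u : EuclideanSpace ℝ (Fin n) → ℝ) : Prop :=
  ∀ K ⊆ Ω, IsCompact K → Convex ℝ K → ∃ C : ℝ, SemiconcaveWith C K u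

/-- The function `F(w,p,A) = -⟨Ap,p⟩ - (1/w)(|p|⁴ + |p|²/2)`. -/
def Ffun {n : ℕ} (w : ℝ) (p : EuclideanSpace ℝ (Fin n))
    (A : EuclideanSpace ℝ (Fin n) →L[ℝ] EuclideanSpace ℝ (Fin n)) : ℝ :=
  -⟪A p, p⟫ - (1 / w) * (‖p‖ ^ 4 + 1 / 2 * ‖p‖ ^ 2)

/-- Restricted viscosity supersolution of `F(w,∇w,∇²w) = 0` in `Ω`. -/
def IsRestrictedSupersol {n : ℕ} (Ω : Set (EuclideanSpace ℝ (Fin n)))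
    (w : EuclideanSpace ℝ (Fin n) → ℝ) : Prop :=
  LowerSemicontinuousOn w Ω ∧
  ∀ x ∈ Ω, ∀ ψ : EuclideanSpace ℝ (Fin n) → ℝ, ContDiffOn ℝ 2 ψ Ω →
    ψ x = w x → (∀ y ∈ Ω, ψ y ≤ w y) →
    0 ≤ Ffun (w x) (gradient ψ x) (hessianCLM ψ x) ∧
    (gradient ψ x = 0 → lamMin (hessianCLM ψ x) ≤ -1 / (2 * w x))

/-- Restricted viscosity subsolution of `F(w,∇w,∇²w) = 0` in `Ω`. -/
def IsRestrictedSubsol {n : ℕ} (Ω : Set (EuclideanSpace ℝ (Fin n)))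
    (w : EuclideanSpace ℝ (Fin n) → ℝ) : Prop :=
  UpperSemicontinuousOn w Ω ∧
  ∀ x ∈ Ω, ∀ ψ : EuclideanSpace ℝ (Fin n) → ℝ, ContDiffOn ℝ 2 ψ Ω →
    ψ x = w x → (∀ y ∈ Ω, w y ≤ ψ y) →
    Ffun (w x) (gradient ψ x) (hessianCLM ψ x) ≤ 0 ∧
    (gradient ψ x = 0 → -1 / (2 * w x) ≤ lamMax (hessianCLM ψ x))

/-- `Ω` satisfies an interior sphere condition. -/
def InteriorSphere {n : ℕ} (Ω : Set (EuclideanSpace ℝ (Fin n))) : Prop :=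
  ∀ z ∈ frontier Ω, ∃ y R, 0 < R ∧ ball y R ⊆ Ω ∧ z ∈ sphere y R

/-- The superdifferential of `u` at `x₀` (relative to `Ω`). -/
def superDiff {n : ℕ} (Ω : Set (EuclideanSpace ℝ (Fin n)))
    (u : EuclideanSpace ℝ (Fin n) → ℝ) (x₀ : EuclideanSpace ℝ (Fin n)) :
    Set (EuclideanSpace ℝ (Fin n)) :=
  {p | ∀ ε > 0, ∃ δ > 0, ∀ x ∈ Ω, ‖x - x₀‖ < δ →
    u x - u x₀ - ⟪p, x - x₀⟫ ≤ ε * ‖x - x₀‖}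

end

/-- The square of a nonnegative `M`-Lipschitz concave function is
semiconcave with constant `2M²`. -/
theorem sq_of_lipschitz_concave_semiconcave (n : ℕ)
    (K : Set (EuclideanSpace ℝ (Fin n))) (hK : Convex ℝ K)
    (M : ℝ) (hM : 0 ≤ M)
    (v : EuclideanSpace ℝ (Fin n) → ℝ)
    (hvnonneg : ∀ x ∈ K, 0 ≤ v x)
    (hvconc : ConcaveOn ℝ K v)
    (hvlip : ∀ x ∈ K, ∀ y ∈ K, |v x - v y| ≤ M * ‖x - y‖) :
    ∀ x ∈ K, ∀ y ∈ K, ∀ t : ℝ, 0 ≤ t → t ≤ 1 →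
      t * v x ^ 2 + (1 - t) * v y ^ 2 - M ^ 2 * (t * (1 - t)) * ‖x - y‖ ^ 2 ≤
        v (t • x + (1 - t) • y) ^ 2 := by
  intro x hx y hy t ht ht1
  have hs : 0 ≤ 1 - t := sub_nonneg.2 ht1
  have hconc := hvconc.2 hx hy ht hs (add_sub_cancel t 1)
  simp only [smul_eq_mul] at hconc
  have hmean : 0 ≤ t * v x + (1 - t) * v y :=
    add_nonneg (mul_nonneg ht (hvnonneg x hx)) (mul_nonneg hs (hvnonneg y hy))
  have hsq : (t * v x + (1 - t) * v y) ^ 2 ≤ v (t • x + (1 - t) • y) ^ 2 :=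
    pow_le_pow_left₀ hmean hconc 2
  have hlip : (v x - v y) ^ 2 ≤ (M * ‖x - y‖) ^ 2 :=
    sq_le_sq' (abs_le.1 (hvlip x hx y hy)).1 (abs_le.1 (hvlip x hx y hy)).2
  have hvar := mul_le_mul_of_nonneg_left hlip (mul_nonneg ht hs)
  linarith
end

section
/- Let Ω ⊂ ℝ^n be an open bounded convex set and let u ∈ C(cl Ω) be a viscosity solution of the Dirichlet problem −Δ∞^N u = 1 in Ω, u = 0 on ∂Ω. Let B_R(y) ⊆ Ω be a ball with a point x₁ ∈ ∂B_R(y) ∩ ∂Ω, and set ν := (y − x₁)/R. Then lim_{λ→0⁺} u(x₁ + λν)^{1/2}/λ = +∞; that is, the inner normal derivative of u^{1/2} at x₁ equals +∞. -/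
open Set Metric Filter
open scoped RealInnerProductSpace

/-- The gradient of the paraboloid `b - a ‖x - y‖²`. -/
theorem hasGradientAt_paraboloid {n : ℕ} (y : EuclideanSpace ℝ (Fin n)) (a b : ℝ)
    (x : EuclideanSpace ℝ (Fin n)) :
    HasGradientAt (fun z => b - a * ‖z - y‖ ^ 2) ((-(2 * a)) • (x - y)) x := by
  rw [hasGradientAt_iff_hasFDerivAt]
  have h := ((((hasFDerivAt_id x).sub_const y).norm_sq).const_mul a).const_sub b
  refine h.congr_fderiv ?_
  ext v
  simp
  ring

theorem gradient_paraboloid {n : ℕ} (y : EuclideanSpace ℝ (Fin n)) (a b : ℝ) :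
    gradient (fun z => b - a * ‖z - y‖ ^ 2) = fun x => (-(2 * a)) • (x - y) :=
  funext fun x => (hasGradientAt_paraboloid y a b x).gradient

theorem hessianCLM_paraboloid {n : ℕ} (y : EuclideanSpace ℝ (Fin n)) (a b : ℝ)
    (x : EuclideanSpace ℝ (Fin n)) :
    hessianCLM (fun z => b - a * ‖z - y‖ ^ 2) x =
      (-(2 * a)) • ContinuousLinearMap.id ℝ (EuclideanSpace ℝ (Fin n)) := by
  rw [hessianCLM, gradient_paraboloid]
  exact (((hasFDerivAt_id x).sub_const y).const_smul (-(2 * a))).fderiv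

theorem le_lamMin_smul_id {n : ℕ} {a : ℝ} (ha : a ≤ 0) :
    a ≤ lamMin (a • ContinuousLinearMap.id ℝ (EuclideanSpace ℝ (Fin n))) := by
  refine Real.le_sInf ?_ ha
  rintro _ ⟨v, hv, rfl⟩
  have hv' : ‖v‖ = 1 := hv
  simp [inner_smul_left, hv']

/-- A paraboloid which is not concave enough cannot touch a supersolution of `-Δ∞^N u = 1`
from below. -/
theorem IsNSupersol.not_touching_paraboloid {n : ℕ} {Ω : Set (EuclideanSpace ℝ (Fin n))}
    {u : EuclideanSpace ℝ (Fin n) → ℝ} (hu : IsNSupersol Ω (fun _ => 1) u)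
    {x : EuclideanSpace ℝ (Fin n)} (hx : x ∈ Ω) (y : EuclideanSpace ℝ (Fin n)) {a b : ℝ}
    (ha : 0 ≤ a) (ha' : 2 * a < 1) (hxu : b - a * ‖x - y‖ ^ 2 = u x) :
    ¬ ∀ z ∈ Ω, b - a * ‖z - y‖ ^ 2 ≤ u z := by
  intro hle
  have hsmooth : ContDiffOn ℝ 2 (fun z => b - a * ‖z - y‖ ^ 2) Ω :=
    (contDiff_const.sub (contDiff_const.mul
      ((contDiff_id.sub contDiff_const).norm_sq ℝ))).contDiffOn
  obtain ⟨hne, hz⟩ := hu.2 x hx (fun z => b - a * ‖z - y‖ ^ 2) hsmooth hxu hle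
  rw [hessianCLM_paraboloid] at hz
  rw [infLap, hessianCLM_paraboloid] at hne
  by_cases hg : gradient (fun z => b - a * ‖z - y‖ ^ 2) x = 0
  · have := hz hg
    have := le_lamMin_smul_id (n := n) (a := -(2 * a)) (by linarith)
    linarith
  · have h1 := hne hg
    have h2 : 0 < ‖gradient (fun z => b - a * ‖z - y‖ ^ 2) x‖ ^ 2 :=
      pow_pos (norm_pos_iff.mpr hg) 2
    simp only [smul_apply, ContinuousLinearMap.id_apply, inner_smul_left,
      real_inner_self_eq_norm_sq, conj_trivial] at h1
    nlinarith

/-- A solution of the Dirichlet problem lies above the paraboloid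
`(R² - ‖x - y‖²) / 4` on every ball `B_R(y)` contained in the domain. -/
theorem IsDirichletSol.paraboloid_le {n : ℕ} {Ω : Set (EuclideanSpace ℝ (Fin n))}
    (hΩo : IsOpen Ω) (hΩb : Bornology.IsBounded Ω) {u : EuclideanSpace ℝ (Fin n) → ℝ}
    (hu : IsDirichletSol Ω u) {y : EuclideanSpace ℝ (Fin n)} {R : ℝ} (hR : 0 ≤ R)
    (hball : ball y R ⊆ Ω) {x : EuclideanSpace ℝ (Fin n)} (hx : x ∈ Ω) :
    1 / 4 * (R ^ 2 - ‖x - y‖ ^ 2) ≤ u x := by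
  obtain ⟨hc, hb, -, hsuper⟩ := hu
  have hcont : ContinuousOn (fun z => u z - 1 / 4 * (R ^ 2 - ‖z - y‖ ^ 2)) (closure Ω) :=
    hc.sub (by fun_prop)
  obtain ⟨z, hz, hmin⟩ :=
    hΩb.isCompact_closure.exists_isMinOn ⟨x, subset_closure hx⟩ hcont
  have hmin' : ∀ w ∈ Ω, u z - 1 / 4 * (R ^ 2 - ‖z - y‖ ^ 2) ≤
      u w - 1 / 4 * (R ^ 2 - ‖w - y‖ ^ 2) := fun w hw => hmin (subset_closure hw)
  have hzΩ : z ∉ Ω := fun hzΩ =>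
    hsuper.not_touching_paraboloid hzΩ y (a := 1 / 4)
      (b := u z + 1 / 4 * ‖z - y‖ ^ 2) (by norm_num) (by norm_num) (by ring)
      fun w hw => by linarith [hmin' w hw]
  have huz : u z = 0 := hb z ⟨hz, by rwa [hΩo.interior_eq]⟩
  have hRz : R ≤ ‖z - y‖ := by
    by_contra! h
    exact hzΩ (hball (mem_ball_iff_norm.mpr h))
  have := pow_le_pow_left₀ hR hRz 2
  linarith [hmin' x hx]

/-- The inner normal derivative of `u^{1/2}` at a boundary point
touched from inside by a ball is `+∞`. -/
theorem sqrt_normal_derivative_infinite (n : ℕ) (Ω : Set (EuclideanSpace ℝ (Fin n)))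
    (hΩo : IsOpen Ω) (hΩb : Bornology.IsBounded Ω) (hΩc : Convex ℝ Ω)
    (u : EuclideanSpace ℝ (Fin n) → ℝ) (hu : IsDirichletSol Ω u)
    (y : EuclideanSpace ℝ (Fin n)) (R : ℝ) (hR : 0 < R) (hball : ball y R ⊆ Ω)
    (x₁ : EuclideanSpace ℝ (Fin n)) (hx₁s : x₁ ∈ sphere y R) (hx₁b : x₁ ∈ frontier Ω)
    (ν : EuclideanSpace ℝ (Fin n)) (hν : ν = R⁻¹ • (y - x₁)) :
    Filter.Tendsto (fun t : ℝ => Real.sqrt (u (x₁ + t • ν)) / t)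
      (nhdsWithin 0 (Ioi 0)) Filter.atTop := by
  have hn : ‖x₁ - y‖ = R := mem_sphere_iff_norm.mp hx₁s
  have hdist : ∀ t ∈ Ioo (0 : ℝ) R, ‖x₁ + t • ν - y‖ = R - t := fun t ht => by
    have h : x₁ + t • ν - y = ((R - t) / R) • (x₁ - y) := by
      rw [hν, sub_div, div_self hR.ne', div_eq_mul_inv]
      module
    rw [h, norm_smul, hn, Real.norm_of_nonneg (div_nonneg (sub_nonneg.mpr ht.2.le) hR.le),
      div_mul_cancel₀ _ hR.ne']
  have hlower : ∀ t ∈ Ioo (0 : ℝ) R, √(R / 4 * t⁻¹) ≤ √(u (x₁ + t • ν)) / t := fun t ht => by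
    have hmem : x₁ + t • ν ∈ Ω := hball (mem_ball_iff_norm.mpr (by linarith [hdist t ht, ht.1]))
    have hle := hu.paraboloid_le hΩo hΩb hR.le hball hmem
    rw [hdist t ht] at hle
    rw [le_div_iff₀ ht.1]
    apply Real.le_sqrt_of_sq_le
    rw [mul_pow, Real.sq_sqrt (by have := ht.1; positivity)]
    have h : R / 4 * t⁻¹ * t ^ 2 = R / 4 * t := by
      have := ht.1.ne'
      field_simp
    rw [h]
    nlinarith [ht.1, ht.2]
  refine tendsto_atTop_mono' _ (Filter.eventually_of_mem (Ioo_mem_nhdsGT hR) hlower) ?_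
  exact Real.tendsto_sqrt_atTop.comp (tendsto_inv_nhdsGT_zero.const_mul_atTop (by positivity))
end
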